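/- arXiv:1209.0002 — 3 statements merged into one kernel-verified Lean document; each statement's English description precedes it below -/
import Mathlib

section
/- Let A, W ∈ SL(2,ℂ), set x := tr A, y := tr W, z := tr(A·W), β := tr(A·W·A·W⁻¹), and for an integer m let U := (A·W·A·W⁻¹)^(1−m) · W. Then tr U = y·S_{m−1}(β) − (x·z − y)·S_{m−2}(β). -/
open Polynomial

/-- The trace of an element of `SL(2,ℂ)`, i.e. the trace of the underlying matrix. -/
noncomputable def tr (A : Matrix.SpecialLinearGroup (Fin 2) ℂ) : ℂ :=
  Matrix.trace (A : Matrix (Fin 2) (Fin 2) ℂ)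

/-- The normalized Chebyshev polynomials `S k` (`k : ℤ`), determined by
`S 0 = 1`, `S 1 = X`, and the recurrence `S (k + 1) = X * S k - S (k - 1)` for all `k : ℤ`. -/
@[semireducible] noncomputable def chebS (R : Type*) [CommRing R] : ℤ → R[X]
  | 0 => 1
  | 1 => X
  | (n : ℕ) + 2 => X * chebS R (n + 1) - chebS R n
  | -((n : ℕ) + 1) => X * chebS R (-n) - chebS R (-n + 1)
  termination_by n => Int.natAbs n + Int.natAbs (n - 1)

theorem chebS_add_two (R : Type*) [CommRing R] :
    ∀ n : ℤ, chebS R (n + 2) = X * chebS R (n + 1) - chebS R n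
  | (k : ℕ) => chebS.eq_3 R k
  | -(k + 1 : ℕ) => by linear_combination (norm := (simp [Int.negSucc_eq]; ring_nf)) chebS.eq_4 R k

theorem chebS_zero (R : Type*) [CommRing R] : chebS R 0 = 1 := by simp [chebS]

theorem chebS_one (R : Type*) [CommRing R] : chebS R 1 = X := by simp [chebS]

theorem chebS_neg_one (R : Type*) [CommRing R] : chebS R (-1) = 0 := by
  have h := chebS_add_two R (-1)
  norm_num [chebS_zero, chebS_one] at h
  linear_combination h

theorem tr_mul_add_tr_inv_mul (g h : Matrix.SpecialLinearGroup (Fin 2) ℂ) :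
    tr (g * h) + tr (g⁻¹ * h) = tr g * tr h := by
  simp [tr, Matrix.trace_fin_two, Matrix.mul_apply, Matrix.adjugate_fin_two, Matrix.vecMul,
    dotProduct]
  ring

theorem tr_mul_comm (g h : Matrix.SpecialLinearGroup (Fin 2) ℂ) : tr (g * h) = tr (h * g) := by
  simpa [tr] using Matrix.trace_mul_comm g.1 h.1

theorem tr_zpow_neg_mul (B V : Matrix.SpecialLinearGroup (Fin 2) ℂ) (n : ℤ) :
    tr (B ^ (-n) * V)
      = tr V * (chebS ℂ n).eval (tr B) - tr (B * V) * (chebS ℂ (n - 1)).eval (tr B) := by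
  have rec_tr (k : ℤ) :
      tr (B ^ (-(k + 1)) * V) + tr (B ^ (-(k - 1)) * V) = tr B * tr (B ^ (-k) * V) := by
    rw [← tr_mul_add_tr_inv_mul, ← mul_assoc, ← mul_assoc, ← zpow_one_add, ← zpow_neg_one,
      ← zpow_add, add_comm]
    ring_nf
  have rec_S (k : ℤ) : (chebS ℂ (k + 1)).eval (tr B)
      = tr B * (chebS ℂ k).eval (tr B) - (chebS ℂ (k - 1)).eval (tr B) := by
    have h := chebS_add_two ℂ (k - 1)
    rw [show k - 1 + 2 = k + 1 by ring, sub_add_cancel] at h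
    simp [h]
  induction n using Polynomial.Chebyshev.induct with
  | zero => simp [chebS_zero, chebS_neg_one]
  | one =>
    have h := rec_tr 0
    simp only [zero_add, zero_sub, neg_neg, neg_zero, zpow_zero, zpow_one, one_mul] at h
    simp only [chebS_one, sub_self, chebS_zero, eval_X, eval_one]
    linear_combination h
  | add_two n h1 h0 =>
    have h := rec_tr (n + 1)
    have hS := rec_S (n + 1)
    have hS_prev := rec_S n
    rw [show (n : ℤ) + 1 + 1 = n + 2 by ring, add_sub_cancel_right] at h hS
    rw [add_sub_cancel_right] at h1
    rw [show (n : ℤ) + 2 - 1 = n + 1 by ring]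
    linear_combination h - h0 + tr B * h1 - tr V * hS + tr (B * V) * hS_prev
  | neg_add_one n h0 h1 =>
    have h := rec_tr (-n)
    have hS := rec_S (-n)
    have hS_prev := rec_S (-n - 1)
    rw [sub_add_cancel] at hS_prev
    rw [add_sub_cancel_right] at h1
    linear_combination h - h1 + tr B * h0 - tr V * hS + tr (B * V) * hS_prev

/-- With `x = tr A`, `y = tr W`, `z = tr (A*W)`, `β = tr (A*W*A*W⁻¹)` and
`U = (A*W*A*W⁻¹)^(1-m) * W`, one has `tr U = y * S (m-1) (β) - (x*z - y) * S (m-2) (β)`. -/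
theorem trace_U (A W : Matrix.SpecialLinearGroup (Fin 2) ℂ) (m : ℤ) :
    tr ((A * W * A * W⁻¹) ^ (1 - m) * W)
      = tr W * (chebS ℂ (m - 1)).eval (tr (A * W * A * W⁻¹))
        - (tr A * tr (A * W) - tr W) * (chebS ℂ (m - 2)).eval (tr (A * W * A * W⁻¹)) := by
  have hBW : tr (A * W * A * W⁻¹ * W) = tr A * tr (A * W) - tr W := by
    have h := tr_mul_add_tr_inv_mul A (A * W)
    rw [inv_mul_cancel_left] at h
    rw [inv_mul_cancel_right, tr_mul_comm, ← h, add_sub_cancel_right]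
  rw [← hBW, show 1 - m = -(m - 1) by ring, show m - 2 = m - 1 - 1 by ring]
  exact tr_zpow_neg_mul _ _ _
end

section
/- Fix an integer m. In the ring R[y] of polynomials in y with coefficients in R := ℂ[x,z], set β := x·y·z + 2 − y² − z² and α := y·S_{m−1}(β) − (x·z − y)·S_{m−2}(β). Then: (i) α has y-degree |2m−1| and leading coefficient (−1)^(m−1); (ii) if m ≥ 0 then S_m(β) − S_{m−1}(β) has y-degree 2m and leading coefficient (−1)^m, and if m ≤ −1 then S_m(β) − S_{m−1}(β) has y-degree −2(m+1) and leading coefficient (−1)^(m−1). -/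
open Polynomial

/-- The variable `x`, viewed as a constant polynomial in `y` over `R = ℂ[x,z]`. -/
noncomputable def xP : Polynomial (MvPolynomial (Fin 2) ℂ) := Polynomial.C (MvPolynomial.X 0)

/-- The variable `z`, viewed as a constant polynomial in `y` over `R = ℂ[x,z]`. -/
noncomputable def zP : Polynomial (MvPolynomial (Fin 2) ℂ) := Polynomial.C (MvPolynomial.X 1)

/-- `β = x*y*z + 2 - y² - z²` as a polynomial in `y` over `R = ℂ[x,z]`. -/
noncomputable def betaP : Polynomial (MvPolynomial (Fin 2) ℂ) :=
  xP * Polynomial.X * zP + 2 - Polynomial.X ^ 2 - zP ^ 2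

/-- `α = y * S (m-1) (β) - (x*z - y) * S (m-2) (β)` as a polynomial in `y` over `ℂ[x,z]`. -/
noncomputable def alphaP (m : ℤ) : Polynomial (MvPolynomial (Fin 2) ℂ) :=
  Polynomial.X * (chebS (Polynomial (MvPolynomial (Fin 2) ℂ)) (m - 1)).eval betaP
    - (xP * zP - Polynomial.X) * (chebS (Polynomial (MvPolynomial (Fin 2) ℂ)) (m - 2)).eval betaP

theorem chebS_eq_chebyshev (R : Type*) [CommRing R] (k : ℤ) : chebS R k = Chebyshev.S R k := by
  induction k using chebS.induct with
  | case1 => simp [chebS]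
  | case2 => simp [chebS]
  | case3 n ih₁ ih₂ => rw [chebS, ih₁, ih₂, ← Chebyshev.S_add_two]; rfl
  | case4 n ih₁ ih₂ =>
    rw [chebS, ih₁, ih₂, ← Chebyshev.S_sub_one, Int.negSucc_eq, neg_add']

section EvalChebyshev

variable {A : Type*} [CommRing A] [IsDomain A] {b : A[X]}

/-- If `b` has degree two and leading coefficient `-1`, then `S n (b)` has degree `2n` and leading
coefficient `(-1)^n`, and it dominates `S (n-1) (b)`. -/
theorem degree_leadingCoeff_eval_chebyshevS (hb : b.degree = 2) (hb' : b.leadingCoeff = -1)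
    (n : ℕ) :
    ((Chebyshev.S A[X] n).eval b).degree = (2 * n : ℕ) ∧
      ((Chebyshev.S A[X] n).eval b).leadingCoeff = (-1) ^ n ∧
      ((Chebyshev.S A[X] (n - 1)).eval b).degree < (2 * n : ℕ) := by
  induction n with
  | zero => simp
  | succ n ih =>
    obtain ⟨hd, hc, hlt⟩ := ih
    have hmul : (b * (Chebyshev.S A[X] n).eval b).degree = (2 * (n + 1) : ℕ) := by
      rw [degree_mul, hb, hd]
      norm_cast
      ring_nf
    have hlt' : ((Chebyshev.S A[X] (n - 1)).eval b).degree
        < (b * (Chebyshev.S A[X] n).eval b).degree := by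
      rw [hmul]
      exact hlt.trans (by norm_cast; omega)
    have hrec : (Chebyshev.S A[X] (n + 1 : ℕ)).eval b
        = b * (Chebyshev.S A[X] n).eval b - (Chebyshev.S A[X] (n - 1)).eval b := by
      push_cast
      rw [Chebyshev.S_add_one]
      simp
    refine ⟨?_, ?_, ?_⟩
    · rw [hrec, degree_sub_eq_left_of_degree_lt hlt', hmul]
    · rw [hrec, leadingCoeff_sub_of_degree_lt hlt', leadingCoeff_mul, hb', hc, pow_succ']
    · rw [show ((n + 1 : ℕ) : ℤ) - 1 = n by push_cast; ring, hd]
      norm_cast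
      omega

/-- The difference `S n (b) - S (n-1) (b)` inherits degree and leading coefficient
from `S n (b)`. -/
theorem natDegree_leadingCoeff_eval_chebyshevS_sub (hb : b.degree = 2) (hb' : b.leadingCoeff = -1)
    (n : ℕ) :
    ((Chebyshev.S A[X] n).eval b - (Chebyshev.S A[X] (n - 1)).eval b).natDegree = 2 * n ∧
      ((Chebyshev.S A[X] n).eval b - (Chebyshev.S A[X] (n - 1)).eval b).leadingCoeff
        = (-1) ^ n := by
  obtain ⟨hd, hc, hlt⟩ := degree_leadingCoeff_eval_chebyshevS hb hb' n
  rw [← hd] at hlt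
  exact ⟨natDegree_eq_of_degree_eq_some ((degree_sub_eq_left_of_degree_lt hlt).trans hd),
    (leadingCoeff_sub_of_degree_lt hlt).trans hc⟩

/-- For `p`, `q` of degree one, the product `p * S n (b)` dominates `q * S (n-1) (b)`. -/
theorem natDegree_leadingCoeff_mul_eval_chebyshevS_sub (hb : b.degree = 2)
    (hb' : b.leadingCoeff = -1) {p q : A[X]} (hp : p.degree = 1) (hq : q.degree = 1) (n : ℕ) :
    (p * (Chebyshev.S A[X] n).eval b - q * (Chebyshev.S A[X] (n - 1)).eval b).natDegree
        = 2 * n + 1 ∧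
      (p * (Chebyshev.S A[X] n).eval b - q * (Chebyshev.S A[X] (n - 1)).eval b).leadingCoeff
        = p.leadingCoeff * (-1) ^ n := by
  obtain ⟨hd, hc, hlt⟩ := degree_leadingCoeff_eval_chebyshevS hb hb' n
  have hmul : (p * (Chebyshev.S A[X] n).eval b).degree = (2 * n + 1 : ℕ) := by
    rw [degree_mul, hp, hd]
    norm_cast
    ring_nf
  have hlt' : (q * (Chebyshev.S A[X] (n - 1)).eval b).degree
      < (p * (Chebyshev.S A[X] n).eval b).degree := by
    rw [degree_mul, degree_mul, hp, hq, hd]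
    exact WithBot.add_lt_add_left (by simp) hlt
  exact ⟨natDegree_eq_of_degree_eq_some ((degree_sub_eq_left_of_degree_lt hlt').trans hmul),
    by rw [leadingCoeff_sub_of_degree_lt hlt', leadingCoeff_mul, hc]⟩

end EvalChebyshev

theorem betaP_eq : betaP = C (-1) * X ^ 2 + C (MvPolynomial.X 0 * MvPolynomial.X 1) * X
    + C (2 - MvPolynomial.X 1 ^ 2) := by
  simp only [betaP, xP, zP, map_neg, map_one, map_mul, map_sub, map_pow, map_ofNat]
  ring

theorem degree_betaP : betaP.degree = 2 := by
  rw [betaP_eq, degree_quadratic (by simp)]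

theorem leadingCoeff_betaP : betaP.leadingCoeff = -1 := by
  rw [betaP_eq, leadingCoeff_quadratic (by simp)]

theorem xP_mul_zP_sub_X_eq :
    xP * zP - X = C (-1) * X + C (MvPolynomial.X 0 * MvPolynomial.X 1) := by
  simp only [xP, zP, map_neg, map_one, map_mul]
  ring

theorem degree_xP_mul_zP_sub_X : (xP * zP - X).degree = 1 := by
  rw [xP_mul_zP_sub_X_eq, degree_linear (by simp)]

theorem leadingCoeff_xP_mul_zP_sub_X : (xP * zP - X).leadingCoeff = -1 := by
  rw [xP_mul_zP_sub_X_eq, leadingCoeff_linear (by simp)]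

theorem alphaP_natCast_add_one (n : ℕ) :
    alphaP (n + 1) = X * (Chebyshev.S _ n).eval betaP
      - (xP * zP - X) * (Chebyshev.S _ (n - 1)).eval betaP := by
  rw [alphaP, chebS_eq_chebyshev, chebS_eq_chebyshev, show (n : ℤ) + 1 - 1 = n by ring,
    show (n : ℤ) + 1 - 2 = n - 1 by ring]

theorem alphaP_neg_natCast (n : ℕ) :
    alphaP (-n) = (xP * zP - X) * (Chebyshev.S _ n).eval betaP
      - X * (Chebyshev.S _ (n - 1)).eval betaP := by
  rw [alphaP, chebS_eq_chebyshev, chebS_eq_chebyshev, Chebyshev.S_neg_sub_one,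
    Chebyshev.S_neg_sub_two, eval_neg, eval_neg]
  ring

theorem natDegree_leadingCoeff_alphaP (m : ℤ) :
    (alphaP m).natDegree = (2 * m - 1).natAbs ∧
      (alphaP m).leadingCoeff = MvPolynomial.C ((-1 : ℂ) ^ (m - 1)) := by
  obtain ⟨n, rfl⟩ | ⟨n, rfl⟩ : (∃ n : ℕ, m = n + 1) ∨ ∃ n : ℕ, m = -n := by
    rcases le_or_gt m 0 with h | h
    · exact .inr ⟨m.natAbs, by omega⟩
    · exact .inl ⟨(m - 1).toNat, by omega⟩
  · obtain ⟨hd, hc⟩ := natDegree_leadingCoeff_mul_eval_chebyshevS_sub degree_betaP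
      leadingCoeff_betaP degree_X degree_xP_mul_zP_sub_X n
    rw [alphaP_natCast_add_one, hd, hc]
    exact ⟨by omega, by simp⟩
  · obtain ⟨hd, hc⟩ := natDegree_leadingCoeff_mul_eval_chebyshevS_sub degree_betaP
      leadingCoeff_betaP degree_xP_mul_zP_sub_X degree_X n
    rw [alphaP_neg_natCast, hd, hc, leadingCoeff_xP_mul_zP_sub_X]
    refine ⟨by omega, ?_⟩
    rw [zpow_sub_one₀ (by simp), zpow_neg, zpow_natCast, ← inv_pow]
    simp [inv_neg]

/-- (i) `α` has `y`-degree `|2m-1|` and leading coefficient `(-1)^(m-1)`;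
(ii) if `m ≥ 0` then `S m (β) - S (m-1) (β)` has `y`-degree `2m` and leading coefficient
`(-1)^m`, and if `m ≤ -1` then it has `y`-degree `-2(m+1)` and leading coefficient
`(-1)^(m-1)`. -/
theorem alpha_degree_leadingCoeff (m : ℤ) :
    ((alphaP m).natDegree = (2 * m - 1).natAbs ∧
      (alphaP m).leadingCoeff = MvPolynomial.C ((-1 : ℂ) ^ (m - 1))) ∧
    (m ≥ 0 →
      ((chebS (Polynomial (MvPolynomial (Fin 2) ℂ)) m).eval betaP
          - (chebS (Polynomial (MvPolynomial (Fin 2) ℂ)) (m - 1)).eval betaP).natDegree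
        = (2 * m).toNat ∧
      ((chebS (Polynomial (MvPolynomial (Fin 2) ℂ)) m).eval betaP
          - (chebS (Polynomial (MvPolynomial (Fin 2) ℂ)) (m - 1)).eval betaP).leadingCoeff
        = MvPolynomial.C ((-1 : ℂ) ^ m)) ∧
    (m ≤ -1 →
      ((chebS (Polynomial (MvPolynomial (Fin 2) ℂ)) m).eval betaP
          - (chebS (Polynomial (MvPolynomial (Fin 2) ℂ)) (m - 1)).eval betaP).natDegree
        = (-2 * (m + 1)).toNat ∧
      ((chebS (Polynomial (MvPolynomial (Fin 2) ℂ)) m).eval betaP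
          - (chebS (Polynomial (MvPolynomial (Fin 2) ℂ)) (m - 1)).eval betaP).leadingCoeff
        = MvPolynomial.C ((-1 : ℂ) ^ (m - 1))) := by
  refine ⟨natDegree_leadingCoeff_alphaP m, fun hm => ?_, fun hm => ?_⟩
  · lift m to ℕ using hm
    obtain ⟨hd, hc⟩ := natDegree_leadingCoeff_eval_chebyshevS_sub degree_betaP
      leadingCoeff_betaP m
    rw [chebS_eq_chebyshev, chebS_eq_chebyshev, hd, hc]
    exact ⟨by omega, by simp⟩
  · obtain ⟨n, rfl⟩ : ∃ n : ℕ, m = -n - 1 := ⟨(-m - 1).toNat, by omega⟩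
    obtain ⟨hd, hc⟩ := natDegree_leadingCoeff_eval_chebyshevS_sub degree_betaP
      leadingCoeff_betaP n
    have hneg : (chebS (Polynomial (MvPolynomial (Fin 2) ℂ)) (-n - 1)).eval betaP
        - (chebS (Polynomial (MvPolynomial (Fin 2) ℂ)) (-n - 1 - 1)).eval betaP
        = (Chebyshev.S _ n).eval betaP - (Chebyshev.S _ (n - 1)).eval betaP := by
      rw [chebS_eq_chebyshev, chebS_eq_chebyshev, show (-n - 1 - 1 : ℤ) = -n - 2 by ring,
        Chebyshev.S_neg_sub_one, Chebyshev.S_neg_sub_two, eval_neg, eval_neg]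
      ring
    rw [hneg, hd, hc]
    refine ⟨by omega, ?_⟩
    rw [zpow_sub_one₀ (by simp), zpow_sub_one₀ (by simp), zpow_neg, zpow_natCast, ← inv_pow]
    simp [inv_neg]
end

section
/- Fix an integer m. In the ring R[y] with R := ℂ[x,z], set β := x·y·z + 2 − y² − z² and δ := z²·S_{m−1}(β) + (x·y·z − x²·z² + z² − 1)·S_{m−2}(β) + S_{m−3}(β). Then: if m ≥ 2, δ has y-degree 2m−2 and leading coefficient (−1)^(m−1)·z²; if m = 1, δ = z² − 1; and if m ≤ 0, δ has y-degree 2−2m and leading coefficient (−1)^m. -/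
open Polynomial

/-- `δ = z² * S (m-1) (β) + (x*y*z - x²*z² + z² - 1) * S (m-2) (β) + S (m-3) (β)`
as a polynomial in `y` over `ℂ[x,z]`. -/
noncomputable def deltaP (m : ℤ) : Polynomial (MvPolynomial (Fin 2) ℂ) :=
  zP ^ 2 * (chebS (Polynomial (MvPolynomial (Fin 2) ℂ)) (m - 1)).eval betaP
    + (xP * Polynomial.X * zP - xP ^ 2 * zP ^ 2 + zP ^ 2 - 1)
        * (chebS (Polynomial (MvPolynomial (Fin 2) ℂ)) (m - 2)).eval betaP
    + (chebS (Polynomial (MvPolynomial (Fin 2) ℂ)) (m - 3)).eval betaP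

theorem chebS_eq_S (R : Type*) [CommRing R] (n : ℤ) : chebS R n = Chebyshev.S R n := by
  induction n using Chebyshev.induct with
  | zero => simp [chebS]
  | one => simp [chebS]
  | add_two n ih1 ih0 => rw [chebS_add_two, Chebyshev.S_add_two, ih1, ih0]
  | neg_add_one n ih0 ih1 =>
    have h := chebS_add_two R (-n - 1)
    have h' := Chebyshev.S_add_two R (-n - 1)
    rw [show (-n - 1 + 2 : ℤ) = -n + 1 by ring, show (-n - 1 + 1 : ℤ) = -n by ring] at h h'
    rw [ih0, ih1] at h
    linear_combination h - h'

theorem natDegree_eq_and_leadingCoeff_eq {R : Type*} [Semiring R] {p : R[X]} {N : ℕ} {c : R}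
    (hp : p.natDegree ≤ N) (hc : p.coeff N = c) (hc0 : c ≠ 0) :
    p.natDegree = N ∧ p.leadingCoeff = c := by
  have h : p.natDegree = N := natDegree_eq_of_le_of_coeff_ne_zero hp (hc ▸ hc0)
  exact ⟨h, by rw [leadingCoeff, h, hc]⟩

theorem natDegree_betaP_le : betaP.natDegree ≤ 2 := by
  unfold betaP xP zP
  compute_degree

theorem coeff_betaP_two : betaP.coeff 2 = -1 := by
  unfold betaP xP zP
  compute_degree!

/-- Degree bounds and top coefficient of `S n` evaluated at a polynomial `b` of degree two
with leading coefficient `-1`. -/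
theorem eval_S_of_coeff_two {R : Type*} [CommRing R] {b : R[X]} (hb : b.natDegree ≤ 2)
    (hb2 : b.coeff 2 = -1) (n : ℕ) :
    ((Chebyshev.S R[X] n).eval b).natDegree ≤ 2 * n ∧
    ((Chebyshev.S R[X] n).eval b).coeff (2 * n) = (-1) ^ n ∧
    ((Chebyshev.S R[X] ((n : ℤ) - 1)).eval b).natDegree ≤ 2 * n := by
  induction n with
  | zero => simp
  | succ n ih =>
    obtain ⟨hdeg, hcoeff, hprev⟩ := ih
    have hrec : (Chebyshev.S R[X] ((n + 1 : ℕ) : ℤ)).eval b =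
        b * (Chebyshev.S R[X] n).eval b - (Chebyshev.S R[X] ((n : ℤ) - 1)).eval b := by
      rw [Nat.cast_succ, Chebyshev.S_add_one]
      simp
    have hmul : (b * (Chebyshev.S R[X] n).eval b).natDegree ≤ 2 + 2 * n :=
      natDegree_mul_le_of_le hb hdeg
    rw [hrec, show 2 * (n + 1) = 2 + 2 * n by ring]
    refine ⟨(natDegree_sub_le _ _).trans (max_le hmul (by lia)), ?_, ?_⟩
    · rw [coeff_sub, coeff_mul_add_eq_of_natDegree_le hb hdeg, hb2, hcoeff,
        coeff_eq_zero_of_natDegree_lt (by lia)]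
      ring
    · rw [Nat.cast_succ, add_sub_cancel_right]
      lia

theorem natDegree_middle_coefficient_le :
    (xP * X * zP - xP ^ 2 * zP ^ 2 + zP ^ 2 - 1).natDegree ≤ 1 := by
  unfold xP zP
  compute_degree

/-- If `m ≥ 2` then `δ` has `y`-degree `2m-2` and leading coefficient `(-1)^(m-1) * z²`;
if `m = 1` then `δ = z² - 1`; and if `m ≤ 0` then `δ` has `y`-degree `2-2m` and leading
coefficient `(-1)^m`. -/
theorem delta_degree_leadingCoeff (m : ℤ) :
    (m ≥ 2 →
      (deltaP m).natDegree = (2 * m - 2).toNat ∧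
      (deltaP m).leadingCoeff = MvPolynomial.C ((-1 : ℂ) ^ (m - 1)) * MvPolynomial.X 1 ^ 2) ∧
    (m = 1 → deltaP m = Polynomial.C (MvPolynomial.X 1 ^ 2 - 1)) ∧
    (m ≤ 0 →
      (deltaP m).natDegree = (2 - 2 * m).toNat ∧
      (deltaP m).leadingCoeff = MvPolynomial.C ((-1 : ℂ) ^ m)) := by
  have hS := eval_S_of_coeff_two natDegree_betaP_le coeff_betaP_two
  refine ⟨fun hm => ?_, ?_, fun hm => ?_⟩
  · obtain ⟨n, rfl⟩ : ∃ n : ℕ, m = n + 2 := ⟨(m - 2).toNat, by lia⟩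
    obtain ⟨hdeg, -, hprev⟩ := hS n
    obtain ⟨hdeg', hcoeff', -⟩ := hS (n + 1)
    have hmid := natDegree_mul_le_of_le natDegree_middle_coefficient_le hdeg
    have hz : (zP ^ 2).natDegree ≤ 0 := by simp [zP]
    have htop := natDegree_mul_le_of_le hz hdeg'
    rw [show (2 * ((n : ℤ) + 2) - 2).toNat = 2 * (n + 1) by lia]
    simp only [deltaP, chebS_eq_S]
    rw [show (n : ℤ) + 2 - 1 = (n + 1 : ℕ) by lia, show (n : ℤ) + 2 - 2 = n by lia,
      show (n : ℤ) + 2 - 3 = n - 1 by lia]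
    refine natDegree_eq_and_leadingCoeff_eq ?_ ?_ ?_
    · exact natDegree_add_le_of_degree_le (natDegree_add_le_of_degree_le (by lia) (by lia))
        (by lia)
    · rw [coeff_add, coeff_add, coeff_eq_zero_of_natDegree_lt (hmid.trans_lt (by lia)),
        coeff_eq_zero_of_natDegree_lt (hprev.trans_lt (by lia)), zP, ← C_pow, coeff_C_mul,
        hcoeff', zpow_natCast]
      simp [mul_comm]
    · simp [zpow_ne_zero]
  · rintro rfl
    simp [deltaP, chebS_eq_S, zP, sub_eq_add_neg]
  · obtain ⟨n, rfl⟩ : ∃ n : ℕ, m = -n := ⟨(-m).toNat, by lia⟩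
    obtain ⟨hdeg, -, hprev⟩ := hS n
    obtain ⟨hdeg', hcoeff', -⟩ := hS (n + 1)
    have hmid := natDegree_mul_le_of_le natDegree_middle_coefficient_le ((natDegree_neg _).trans_le hdeg)
    have hz : (zP ^ 2).natDegree ≤ 0 := by simp [zP]
    have hlow := natDegree_mul_le_of_le hz ((natDegree_neg _).trans_le hprev)
    rw [show (2 - 2 * -(n : ℤ)).toNat = 2 * (n + 1) by lia]
    simp only [deltaP, chebS_eq_S]
    rw [show -(n : ℤ) - 3 = -(n + 1 : ℕ) - 2 by lia, Chebyshev.S_neg_sub_two,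
      Chebyshev.S_neg_sub_two, Chebyshev.S_neg_sub_one]
    simp only [eval_neg]
    refine natDegree_eq_and_leadingCoeff_eq ?_ ?_ ?_
    · exact natDegree_add_le_of_degree_le (natDegree_add_le_of_degree_le (by lia) (by lia))
        ((natDegree_neg _).trans_le hdeg')
    · rw [coeff_add, coeff_add, coeff_neg,
        coeff_eq_zero_of_natDegree_lt (hmid.trans_lt (by lia)),
        coeff_eq_zero_of_natDegree_lt (hlow.trans_lt (by lia)), hcoeff', zpow_neg, zpow_natCast,
        ← inv_pow, inv_neg_one]
      simp [pow_succ]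
    · simp
end
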